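/- There is no finite group of order 2688 (= 48·56 = 2⁷·3·7) that has an irreducible complex character of degree 48. -/

import Mathlib

open CategoryTheory

/-- `χ : G → ℂ` is the character of an irreducible (simple) finite-dimensional complex
representation of the group `G`. -/
def IsIrrChar (G : Type) [Group G] (χ : G → ℂ) : Prop :=
  ∃ V : FDRep ℂ G, Simple V ∧ FDRep.character V = χ

open Finset ComplexConjugate

theorem exists_monoidHom_zmod {n : ℕ} {G : Type*} [Group G] {g : G} (h : g ^ n = 1) :
    ∃ φ : Multiplicative (ZMod n) →* G, φ (Multiplicative.ofAdd 1) = g := by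
  refine ⟨AddMonoidHom.toMultiplicativeLeft (ZMod.lift n
    ⟨zmultiplesHom (Additive G) (Additive.ofMul g), ?_⟩), ?_⟩
  · simpa [← ofMul_pow] using h
  · have := ZMod.lift_coe n (⟨zmultiplesHom (Additive G) (Additive.ofMul g), by
      simpa [← ofMul_pow] using h⟩ : {f : ℤ →+ Additive G // f n = 0}) 1
    simpa using congrArg Additive.toMul this

namespace Representation

section Twist

variable {k G V : Type*} [Field k] [Group G] [AddCommGroup V] [Module k V]

/-- The twist of a representation by a linear character. -/
def twist (ρ : Representation k G V) (ψ : G →* k) : Representation k G V where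
  toFun g := ψ g • ρ g
  map_one' := by simp
  map_mul' g h := by simp [smul_smul, mul_comm]

theorem char_twist (ρ : Representation k G V) (ψ : G →* k) (g : G) :
    (ρ.twist ψ).character g = ψ g * ρ.character g := by
  simp [character, twist]

end Twist

variable {V : Type*} [AddCommGroup V] [Module ℂ V] [FiniteDimensional ℂ V]

theorem exists_sum_char_eq_card_mul {G : Type*} [Group G] [Fintype G]
    (ρ : Representation ℂ G V) :
    ∃ m : ℕ, ∑ g, ρ.character g = Nat.card G * m := by
  have hG : (Nat.card G : ℂ) ≠ 0 := Nat.cast_ne_zero.2 Nat.card_pos.ne'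
  let := invertibleOfNonzero hG
  exact ⟨_, (inv_mul_eq_iff_eq_mul₀ hG).1 (card_inv_mul_sum_char_eq_finrank ρ)⟩

theorem exists_sum_char_mul_char_inv_eq_card_mul {G W : Type*} [Group G] [Fintype G]
    [AddCommGroup W] [Module ℂ W] [FiniteDimensional ℂ W]
    (ρ : Representation ℂ G V) (σ : Representation ℂ G W) :
    ∃ m : ℕ, ∑ g, σ.character g * ρ.character g⁻¹ = Nat.card G * m := by
  have hG : (Nat.card G : ℂ) ≠ 0 := Nat.cast_ne_zero.2 Nat.card_pos.ne'
  let := invertibleOfNonzero hG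
  exact ⟨_, (inv_mul_eq_iff_eq_mul₀ hG).1 (card_inv_mul_sum_char_mul_char_eq_finrank ρ σ)⟩

variable {n : ℕ} [NeZero n]

/-- The linear character `a ↦ exp (-2πi a i / n)` of the cyclic group of order `n`. -/
noncomputable def zmodChar (i : ZMod n) : Multiplicative (ZMod n) →* ℂ :=
  (AddChar.mulShift ZMod.stdAddChar (-i)).toMonoidHom

theorem zmodChar_ofAdd (i a : ZMod n) :
    zmodChar i (Multiplicative.ofAdd a) = ZMod.stdAddChar (-(a * i)) := by
  simp [zmodChar, AddChar.mulShift_apply, mul_comm]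

theorem exists_dft_char_eq (ρ : Representation ℂ (Multiplicative (ZMod n)) V) (i : ZMod n) :
    ∃ m : ℕ, ZMod.dft (fun a ↦ ρ.character (Multiplicative.ofAdd a)) i = n * m := by
  obtain ⟨m, hm⟩ := exists_sum_char_eq_card_mul (ρ.twist (zmodChar i))
  refine ⟨m, ?_⟩
  rw [ZMod.dft_apply]
  have hc : Nat.card (Multiplicative (ZMod n)) = n := by simp
  rw [hc] at hm
  rw [← hm, ← Multiplicative.ofAdd.sum_comp]
  simp [char_twist, zmodChar_ofAdd]

theorem char_inv_zmod (ρ : Representation ℂ (Multiplicative (ZMod n)) V) (a : ZMod n) :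
    ρ.character (Multiplicative.ofAdd (-a)) = conj (ρ.character (Multiplicative.ofAdd a)) := by
  choose m hm using exists_dft_char_eq ρ
  have key (b : ZMod n) : ρ.character (Multiplicative.ofAdd b) =
      (n : ℂ)⁻¹ * ∑ i, ZMod.stdAddChar (i * b) * (n * m i) := by
    simp only [← hm]
    have := ZMod.invDFT_apply (ZMod.dft (fun a ↦ ρ.character (Multiplicative.ofAdd a))) b
    rw [LinearEquiv.symm_apply_apply] at this
    simpa using this
  rw [key, key]
  simp only [map_mul, map_sum, map_inv₀, map_natCast, mul_neg, AddChar.map_neg_eq_conj]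

theorem char_inv_eq_conj {G : Type*} [Group G] [Finite G] (ρ : Representation ℂ G V) (g : G) :
    ρ.character g⁻¹ = conj (ρ.character g) := by
  have : NeZero (orderOf g) := ⟨(orderOf_pos g).ne'⟩
  obtain ⟨φ, hφ⟩ := exists_monoidHom_zmod (pow_orderOf_eq_one g)
  have := char_inv_zmod (MonoidHom.comp ρ φ) 1
  simpa [character, hφ] using this

variable {H : Type*} [Group H] [Fintype H]

theorem exists_sum_dft_mul_conj_dft_eq
    (ρ : Representation ℂ (Multiplicative (ZMod n) × H) V) (i j : ZMod n) :
    ∃ m : ℕ, ∑ h, ZMod.dft (fun a ↦ ρ.character (Multiplicative.ofAdd a, h)) i *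
      conj (ZMod.dft (fun a ↦ ρ.character (Multiplicative.ofAdd a, h)) j) =
      n ^ 2 * Nat.card H * m := by
  let A := Multiplicative (ZMod n)
  let p₁ : H × A × A →* A × H :=
    ((MonoidHom.fst A A).comp (MonoidHom.snd H _)).prod (MonoidHom.fst H _)
  let p₂ : H × A × A →* A × H :=
    ((MonoidHom.snd A A).comp (MonoidHom.snd H _)).prod (MonoidHom.fst H _)
  let σ (p : H × A × A →* A × H) (i : ZMod n) : Representation ℂ (H × A × A) V :=
    twist (MonoidHom.comp ρ p) (((zmodChar i).comp (MonoidHom.fst A H)).comp p)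
  have hσ (p i x) : (σ p i).character x = zmodChar i (p x).1 * ρ.character (p x) :=
    char_twist _ _ _
  obtain ⟨m, hm⟩ := exists_sum_char_mul_char_inv_eq_card_mul (σ p₂ j) (σ p₁ i)
  refine ⟨m, ?_⟩
  have hc : (Nat.card (H × A × A) : ℂ) = n ^ 2 * Nat.card H := by
    simp [A]; ring
  rw [← hc, ← hm, Fintype.sum_prod_type]
  refine Finset.sum_congr rfl fun h _ ↦ ?_
  rw [Fintype.sum_prod_type, ZMod.dft_apply, ZMod.dft_apply, map_sum, Finset.sum_mul_sum,
    ← Multiplicative.ofAdd.sum_comp]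
  refine Finset.sum_congr rfl fun a _ ↦ ?_
  rw [← Multiplicative.ofAdd.sum_comp]
  refine Finset.sum_congr rfl fun b _ ↦ ?_
  rw [char_inv_eq_conj, hσ, hσ]
  simp [p₁, p₂, zmodChar_ofAdd]


theorem _root_.ZMod.sum_dft_mul_conj_dft (Φ : ZMod n → ℂ) :
    ∑ i, ZMod.dft Φ i * conj (ZMod.dft Φ i) = n * ∑ a, Φ a * conj (Φ a) := by
  have hinv (a : ZMod n) : ∑ i, ZMod.stdAddChar (i * a) * ZMod.dft Φ i = n * Φ a := by
    have := ZMod.invDFT_apply (ZMod.dft Φ) a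
    rw [LinearEquiv.symm_apply_apply, smul_eq_mul, eq_inv_mul_iff_mul_eq₀ (NeZero.ne _)] at this
    simpa using this.symm
  simp_rw [fun i ↦ congrArg conj (ZMod.dft_apply Φ i), map_sum, Finset.mul_sum]
  rw [Finset.sum_comm]
  refine Finset.sum_congr rfl fun a _ ↦ ?_
  rw [← mul_assoc, ← hinv, Finset.sum_mul]
  refine Finset.sum_congr rfl fun i _ ↦ ?_
  rw [smul_eq_mul, map_mul, ← AddChar.map_neg_eq_conj, neg_neg, mul_comm i a]
  ring

theorem _root_.sum_sum_sub_mul_conj {ι : Type*} [Fintype ι] (F : ι → ℂ) :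
    ∑ i, ∑ j, (F i - F j) * conj (F i - F j) =
      2 * (Fintype.card ι * ∑ i, F i * conj (F i) - (∑ i, F i) * conj (∑ i, F i)) := by
  have h : (∑ i, F i) * conj (∑ i, F i) = ∑ i, ∑ j, F i * conj (F j) := by
    rw [map_sum, Finset.sum_mul_sum]
  have h' : (∑ i, F i) * conj (∑ i, F i) = ∑ i, ∑ j, F j * conj (F i) := by
    rw [h, Finset.sum_comm]
  rw [two_mul]
  nth_rw 1 [h]
  rw [h']
  simp only [map_sub, sub_mul, mul_sub, Finset.sum_sub_distrib, Finset.sum_const,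
    Finset.card_univ, nsmul_eq_mul, ← Finset.mul_sum]
  ring

theorem _root_.two_mul_card_sub_one_le_card_filter_ne {ι α : Type*} [Fintype ι] [DecidableEq α]
    (d : ι → α) (hd : ∃ i j, d i ≠ d j) :
    2 * (Fintype.card ι - 1) ≤ #{x : ι × ι | d x.1 ≠ d x.2} := by
  classical
  obtain ⟨i, j, hij⟩ := hd
  set S : Finset ι := {x | d x = d i} with hS
  have hi : 0 < #S := Finset.card_pos.2 ⟨i, by simp [hS]⟩
  have hj : 0 < #Sᶜ := Finset.card_pos.2 ⟨j, by simpa [hS] using hij.symm⟩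
  have hc : #S + #Sᶜ = Fintype.card ι := Finset.card_add_card_compl S
  have hdisj : Disjoint (S ×ˢ Sᶜ) (Sᶜ ×ˢ S) :=
    Finset.disjoint_product.2 (.inl disjoint_compl_right)
  have hsub : (S ×ˢ Sᶜ).disjUnion (Sᶜ ×ˢ S) hdisj ⊆ ({x : ι × ι | d x.1 ≠ d x.2} : Finset _) := by
    intro x
    simp only [hS, Finset.mem_disjUnion, Finset.mem_product, Finset.mem_compl,
      Finset.mem_filter, Finset.mem_univ, true_and]
    rintro (⟨h, h'⟩ | ⟨h, h'⟩) <;> grind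
  have := Finset.card_le_card hsub
  rw [Finset.card_disjUnion, Finset.card_product, Finset.card_product] at this
  obtain ⟨s, hs⟩ := Nat.exists_eq_add_of_le' hi
  obtain ⟨t, ht⟩ := Nat.exists_eq_add_of_le' hj
  rw [hs, ht] at this hc
  rw [← hc]
  have : 2 * (s + t + 1) ≤ 2 * ((s + 1) * (t + 1)) := by nlinarith
  grind

theorem card_mul_le_sum_norm_sq_char (ρ : Representation ℂ (Multiplicative (ZMod n) × H) V)
    (hρ : ¬ n ∣ Module.finrank ℂ V) :
    ((n - 1 : ℕ) : ℝ) * Nat.card H ≤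
      ∑ a with a ≠ 0, ∑ h, ‖ρ.character (Multiplicative.ofAdd a, h)‖ ^ 2 := by
  set X : H → ZMod n → ℂ := fun h a ↦ ρ.character (Multiplicative.ofAdd a, h) with hX
  set F : H → ZMod n → ℂ := fun h ↦ ZMod.dft (X h) with hF
  have hn : (n : ℂ) ≠ 0 := NeZero.ne _
  obtain ⟨d, hd⟩ : ∃ d : ZMod n → ℕ, ∀ i, F 1 i = n * d i := by
    choose d hd using exists_dft_char_eq (MonoidHom.comp ρ (MonoidHom.inl _ H))
    exact ⟨d, hd⟩
  have hsum (h : H) : ∑ i, F h i = n * X h 0 := by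
    have := ZMod.invDFT_apply (F h) 0
    rw [hF, LinearEquiv.symm_apply_apply, smul_eq_mul, eq_inv_mul_iff_mul_eq₀ hn] at this
    simpa using this.symm
  have hdne : ∃ i j, d i ≠ d j := by
    by_contra! hcon
    apply hρ
    have h1 := hsum 1
    have h0 : X 1 0 = Module.finrank ℂ V := ρ.char_one
    simp only [hd, ← Finset.mul_sum, h0, mul_right_inj' hn] at h1
    simp only [fun i ↦ hcon i 0] at h1
    norm_cast at h1
    simp [ZMod.card] at h1
    exact ⟨_, h1.symm⟩
  choose M hM using exists_sum_dft_mul_conj_dft_eq ρ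
  have hD (i j : ZMod n) : ∑ h, ‖F h i - F h j‖ ^ 2 =
      n ^ 2 * Nat.card H * ((M i i - M i j - M j i + M j j : ℤ) : ℝ) := by
    have : ∑ h, (F h i - F h j) * conj (F h i - F h j) =
      n ^ 2 * Nat.card H * ((M i i - M i j - M j i + M j j : ℤ) : ℂ) := by
      push_cast
      simp only [mul_add, mul_sub, ← hM, ← Finset.sum_sub_distrib, ← Finset.sum_add_distrib]
      refine Finset.sum_congr rfl fun h _ ↦ ?_
      simp only [map_sub]
      ring
    simp only [Complex.mul_conj'] at this
    exact_mod_cast this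
  have hD1 (i j : ZMod n) (hij : d i ≠ d j) :
      (n ^ 2 * Nat.card H : ℝ) ≤ ∑ h, ‖F h i - F h j‖ ^ 2 := by
    have hpos : 0 < ∑ h, ‖F h i - F h j‖ ^ 2 := by
      refine Finset.sum_pos' (fun _ _ ↦ by positivity) ⟨1, Finset.mem_univ _, ?_⟩
      have : F 1 i - F 1 j ≠ 0 := by
        rw [hd, hd, sub_ne_zero]
        simpa [hn] using hij
      positivity
    rw [hD] at hpos ⊢
    have h1 := pos_of_mul_pos_right hpos (by positivity)
    have h2 : (1 : ℝ) ≤ ((M i i - M i j - M j i + M j j : ℤ) : ℝ) := by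
      exact_mod_cast Int.cast_pos.1 h1
    exact le_mul_of_one_le_right (by positivity) h2
  have hpars (h : H) : ∑ i, ∑ j, ‖F h i - F h j‖ ^ 2 = 2 * n ^ 2 * ∑ a with a ≠ 0, ‖X h a‖ ^ 2 := by
    have h1 := sum_sum_sub_mul_conj (F h)
    rw [ZMod.card, ZMod.sum_dft_mul_conj_dft, hsum] at h1
    have h2 : ∑ a, X h a * conj (X h a) = X h 0 * conj (X h 0) +
        ∑ a with a ≠ 0, X h a * conj (X h a) := by
      rw [Finset.filter_ne']
      exact (Finset.add_sum_erase _ (fun a ↦ X h a * conj (X h a)) (Finset.mem_univ 0)).symm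
    rw [h2, map_mul, map_natCast] at h1
    have h3 : ∑ i, ∑ j, (F h i - F h j) * conj (F h i - F h j) =
        2 * n ^ 2 * ∑ a with a ≠ 0, X h a * conj (X h a) := by
      rw [h1]; ring
    simp only [Complex.mul_conj'] at h3
    exact_mod_cast h3
  have htot : ∑ x : ZMod n × ZMod n, ∑ h, ‖F h x.1 - F h x.2‖ ^ 2 =
      2 * n ^ 2 * ∑ a with a ≠ 0, ∑ h, ‖X h a‖ ^ 2 := by
    rw [Finset.sum_comm, Finset.sum_comm (s := Finset.filter _ _), Finset.mul_sum]
    refine Finset.sum_congr rfl fun h _ ↦ ?_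
    rw [← hpars, Fintype.sum_prod_type]
  have hlow : (#{x : ZMod n × ZMod n | d x.1 ≠ d x.2} : ℝ) * (n ^ 2 * Nat.card H) ≤
      ∑ x : ZMod n × ZMod n, ∑ h, ‖F h x.1 - F h x.2‖ ^ 2 := by
    rw [← nsmul_eq_mul]
    refine (Finset.card_nsmul_le_sum _ _ _ fun x hx ↦ hD1 x.1 x.2 (by simpa using hx)).trans ?_
    exact Finset.sum_le_sum_of_subset_of_nonneg (Finset.subset_univ _) fun _ _ _ ↦ by positivity
  have hcnt : (2 * ((n - 1 : ℕ) : ℝ)) ≤ #{x : ZMod n × ZMod n | d x.1 ≠ d x.2} := by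
    have := two_mul_card_sub_one_le_card_filter_ne d hdne
    rw [ZMod.card] at this
    exact_mod_cast this
  rw [htot] at hlow
  have hcnt' := mul_le_mul_of_nonneg_right hcnt
    (show (0 : ℝ) ≤ n ^ 2 * Nat.card H by positivity)
  have hfin := hcnt'.trans hlow
  have hn0 : (0 : ℝ) < n := Nat.cast_pos.2 (NeZero.pos n)
  have h2n : (0 : ℝ) < 2 * n ^ 2 := by positivity
  refine le_of_mul_le_mul_left ?_ h2n
  calc _ = 2 * ((n - 1 : ℕ) : ℝ) * (n ^ 2 * Nat.card H) := by ring
    _ ≤ _ := hfin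

section Singular

variable {G : Type*} [Group G] {p : ℕ} [Fact p.Prime]

theorem _root_.Subgroup.exists_complement_zpowers_centralizer [Finite G] {z : G}
    (hz : orderOf z = p) (hG : ¬ p ^ 2 ∣ Nat.card G) :
    ∃ K : Subgroup G, (∀ k ∈ K, Commute z k) ∧
      Nat.card (Subgroup.centralizer {z}) = p * Nat.card K ∧ p.Coprime (Nat.card K) := by
  set C := Subgroup.centralizer {z} with hC
  let c : C := ⟨z, Subgroup.mem_centralizer_singleton_iff.2 rfl⟩
  have hcomm (x : C) : x * c = c * x :=
    Subtype.ext (Subgroup.mem_centralizer_singleton_iff.1 x.2)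
  have hcard : Nat.card (Subgroup.zpowers c) = p := by
    rw [Nat.card_zpowers, ← hz]
    exact (Subgroup.orderOf_coe c).symm
  have hnorm : (Subgroup.zpowers c).Normal := by
    refine ⟨fun x hx g ↦ ?_⟩
    obtain ⟨k, rfl⟩ := hx
    have : g * c ^ k = c ^ k * g := (Commute.zpow_right (hcomm g) k)
    simp [this]
  have hmul := (Subgroup.zpowers c).card_mul_index
  rw [hcard] at hmul
  have hcop : p.Coprime (Subgroup.zpowers c).index := by
    rw [(Fact.out : p.Prime).coprime_iff_not_dvd]
    intro h
    apply hG
    rw [pow_two]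
    exact ((mul_dvd_mul_left p h).trans hmul.dvd).trans C.card_subgroup_dvd_card
  obtain ⟨K, hK⟩ := Subgroup.exists_right_complement'_of_coprime (N := Subgroup.zpowers c)
    (by rwa [hcard])
  have hKmul := hK.card_mul_card
  have hKcard : Nat.card (K.map C.subtype) = Nat.card K :=
    Subgroup.card_map_of_injective C.subtype_injective
  rw [hcard] at hKmul
  refine ⟨K.map C.subtype, ?_, by rw [hKcard, hKmul], ?_⟩
  · rintro _ ⟨k, -, rfl⟩
    exact congrArg Subtype.val (hcomm k).symm
  · rw [hKcard]
    rwa [← Nat.eq_of_mul_eq_mul_left (Fact.out : p.Prime).pos (hKmul.trans hmul.symm)] at hcop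

theorem _root_.Finset.sum_comp_le_mul_sum {X Y : Type*} [Fintype X] [DecidableEq Y] {π : X → Y}
    {t : Finset Y} {f : Y → ℝ} (hf : ∀ y, 0 ≤ f y) (hπ : ∀ x, π x ∈ t) {c : ℕ}
    (hc : ∀ y, #{x | π x = y} ≤ c) :
    ∑ x, f (π x) ≤ c * ∑ y ∈ t, f y := by
  rw [← Finset.sum_fiberwise_of_maps_to (t := t) (g := π) fun x _ ↦ hπ x, Finset.mul_sum]
  refine Finset.sum_le_sum fun y _ ↦ ?_
  rw [Finset.sum_congr rfl fun x hx ↦ by rw [(Finset.mem_filter.1 hx).2], Finset.sum_const,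
    nsmul_eq_mul]
  exact mul_le_mul_of_nonneg_right (Nat.cast_le.2 (hc y)) (hf y)

variable [Fintype G]

omit [FiniteDimensional ℂ V] in
theorem card_mul_sum_norm_sq_char_le (ρ : Representation ℂ G V) {x : G} (hx : orderOf x = p)
    {K : Subgroup G} [Fintype K] (hK : ∀ k ∈ K, Commute x k) (hp : p.Coprime (Nat.card K)) :
    (Nat.card G : ℝ) * ∑ k : K, ‖ρ.character (x * k)‖ ^ 2 ≤
      Nat.card (Subgroup.centralizer {x}) * ∑ y with p ∣ orderOf y, ‖ρ.character y‖ ^ 2 := by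
  classical
  let π : G × K → G := fun q ↦ q.1 * (x * q.2) * q.1⁻¹
  have hpow (k : K) : (x * k) ^ Nat.card K = x ^ Nat.card K := by
    rw [(hK k k.2).mul_pow, ← Subgroup.coe_pow, pow_card_eq_one']
    simp
  have hπ (q : G × K) : π q ^ Nat.card K = q.1 * x ^ Nat.card K * q.1⁻¹ := by
    simp only [π, conj_pow, hpow]
  have hsum : (Nat.card G : ℝ) * ∑ k : K, ‖ρ.character (x * k)‖ ^ 2 =
      ∑ q, ‖ρ.character (π q)‖ ^ 2 := by
    rw [Fintype.sum_prod_type]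
    simp only [π, char_conj]
    simp
  rw [hsum]
  refine Finset.sum_comp_le_mul_sum (f := fun y ↦ ‖ρ.character y‖ ^ 2)
    (fun _ ↦ by positivity) (fun q ↦ ?_) fun y ↦ ?_
  · rw [Finset.mem_filter]
    refine ⟨Finset.mem_univ _, ?_⟩
    by_contra hdvd
    have hcop := ((Fact.out : p.Prime).coprime_iff_not_dvd.2 hdvd).symm
    have h2 : π q ^ (p * Nat.card K) = 1 := by
      rw [mul_comm, pow_mul, hπ, conj_pow, ← pow_mul, mul_comm, pow_mul, ← hx, pow_orderOf_eq_one]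
      simp
    have h3 : π q ^ Nat.card K = 1 :=
      orderOf_dvd_iff_pow_eq_one.1 (hcop.dvd_of_dvd_mul_left (orderOf_dvd_of_pow_eq_one h2))
    rw [hπ, conj_eq_one_iff, ← orderOf_dvd_iff_pow_eq_one, hx] at h3
    exact ((Fact.out : p.Prime).coprime_iff_not_dvd.1 hp) h3
  · obtain hempty | ⟨⟨g₀, k₀⟩, h₀⟩ := Finset.eq_empty_or_nonempty {q | π q = y}
    · simp [hempty]
    rw [Finset.mem_filter] at h₀
    have hmem (q : G × K) (hq : π q = y) : g₀⁻¹ * q.1 ∈ Subgroup.centralizer {x} := by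
      have h1 : q.1 * x ^ Nat.card K * q.1⁻¹ = g₀ * x ^ Nat.card K * g₀⁻¹ := by
        rw [← hπ q, ← hπ (g₀, k₀), hq, h₀.2]
      have h2 : Commute (g₀⁻¹ * q.1) (x ^ Nat.card K) := by
        rw [commute_iff_eq]
        calc _ = g₀⁻¹ * (q.1 * x ^ Nat.card K * q.1⁻¹) * q.1 := by group
          _ = _ := by rw [h1]; group
      obtain ⟨m, hm⟩ := exists_pow_eq_self_of_coprime (x := x) (n := Nat.card K)
        (by rw [hx]; exact hp.symm)
      rw [Subgroup.mem_centralizer_singleton_iff]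
      have := h2.pow_right m
      rw [hm] at this
      exact this
    rw [← Fintype.card_subtype]
    rw [Nat.card_eq_fintype_card]
    refine Fintype.card_le_of_injective
      (fun q : {q // π q = y} ↦ (⟨g₀⁻¹ * q.1.1, hmem q.1 q.2⟩ : Subgroup.centralizer {x})) ?_
    rintro ⟨⟨g, k⟩, hq⟩ ⟨⟨g', k'⟩, hq'⟩ h
    obtain rfl : g = g' := by simpa using h
    have := hq.trans hq'.symm
    simp only [π, mul_left_inj, mul_right_inj] at this
    simp [Subtype.ext this]

/-- A character whose degree is prime to `p` carries at least `1 / p` of its squared norm on the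
`p`-singular elements, when the Sylow `p`-subgroups have order `p`. -/
theorem card_le_mul_sum_norm_sq_char_singular (ρ : Representation ℂ G V)
    (hpG : p ∣ Nat.card G) (hG : ¬ p ^ 2 ∣ Nat.card G) (hρ : ¬ p ∣ Module.finrank ℂ V) :
    (Nat.card G : ℝ) ≤ p * ∑ y with p ∣ orderOf y, ‖ρ.character y‖ ^ 2 := by
  classical
  obtain ⟨z, hz⟩ := exists_prime_orderOf_dvd_card' p hpG
  obtain ⟨K, hKz, hcard, hcop⟩ := Subgroup.exists_complement_zpowers_centralizer hz hG
  obtain ⟨φ, hφ⟩ := exists_monoidHom_zmod (n := p) (g := z) (by rw [← hz, pow_orderOf_eq_one])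
  have hφa (a : ZMod p) : φ (Multiplicative.ofAdd a) = z ^ a.val := by
    rw [← hφ, ← map_pow, ← ofAdd_nsmul]
    simp
  have hcomm (a : Multiplicative (ZMod p)) (k : K) : Commute (φ a) (K.subtype k) := by
    have := (hKz k k.2).pow_left (Multiplicative.toAdd a).val
    rwa [← hφa] at this
  have hlow := card_mul_le_sum_norm_sq_char
    (MonoidHom.comp ρ (φ.noncommCoprod K.subtype hcomm)) hρ
  have hchar (a : ZMod p) (k : K) :
      character (MonoidHom.comp ρ (φ.noncommCoprod K.subtype hcomm)) (Multiplicative.ofAdd a, k) =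
        ρ.character (φ (Multiplicative.ofAdd a) * k) := rfl
  simp only [hchar] at hlow
  set S := ∑ y with p ∣ orderOf y, ‖ρ.character y‖ ^ 2 with hS
  have hup (a : ZMod p) (ha : a ≠ 0) :
      (Nat.card G : ℝ) * ∑ k : K, ‖ρ.character (φ (Multiplicative.ofAdd a) * k)‖ ^ 2 ≤
        p * Nat.card K * S := by
    have hav : p.Coprime a.val := by
      rw [(Fact.out : p.Prime).coprime_iff_not_dvd]
      intro h
      exact ha ((ZMod.val_eq_zero a).1 (Nat.eq_zero_of_dvd_of_lt h a.val_lt))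
    have hord : orderOf (φ (Multiplicative.ofAdd a)) = p := by
      rw [hφa, Nat.Coprime.orderOf_pow (by rwa [hz]), hz]
    have hcen : Subgroup.centralizer {φ (Multiplicative.ofAdd a)} = Subgroup.centralizer {z} := by
      obtain ⟨m, hm⟩ := exists_pow_eq_self_of_coprime (x := z) (n := a.val)
        (by rw [hz]; exact hav.symm)
      ext g
      rw [Subgroup.mem_centralizer_singleton_iff, Subgroup.mem_centralizer_singleton_iff, hφa]
      refine ⟨fun h ↦ ?_, fun h ↦ Commute.pow_right h _⟩
      have := Commute.pow_right h m
      rwa [hm] at this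
    have := card_mul_sum_norm_sq_char_le ρ hord (fun k hk ↦ hcomm _ ⟨k, hk⟩) hcop
    rw [hcen, hcard] at this
    exact_mod_cast this
  have htot : (Nat.card G : ℝ) * (((p - 1 : ℕ) : ℝ) * Nat.card K) ≤
      ((p - 1 : ℕ) : ℝ) * (p * Nat.card K * S) := by
    refine (mul_le_mul_of_nonneg_left hlow (by positivity)).trans ?_
    rw [Finset.mul_sum]
    refine (Finset.sum_le_card_nsmul _ _ _ fun a ha ↦ hup a (by simpa using ha)).trans ?_
    rw [nsmul_eq_mul, Finset.filter_ne', Finset.card_erase_of_mem (Finset.mem_univ _),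
      Finset.card_univ, ZMod.card]
  have hp1 : (0 : ℝ) < ((p - 1 : ℕ) : ℝ) :=
    Nat.cast_pos.2 (Nat.sub_pos_of_lt (Fact.out : p.Prime).one_lt)
  have hK : (0 : ℝ) < Nat.card K := Nat.cast_pos.2 Nat.card_pos
  refine le_of_mul_le_mul_left ?_ (mul_pos hp1 hK)
  linarith

end Singular

theorem card_dvd_finrank_of_char_eq_zero {G : Type*} [Group G] [Finite G]
    (ρ : Representation ℂ G V) (h : ∀ g ≠ 1, ρ.character g = 0) :
    Nat.card G ∣ Module.finrank ℂ V := by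
  have := Fintype.ofFinite G
  obtain ⟨m, hm⟩ := exists_sum_char_eq_card_mul ρ
  rw [Finset.sum_eq_single 1 (fun g _ hg ↦ h g hg) (by simp), char_one] at hm
  exact ⟨m, by exact_mod_cast hm⟩

end Representation

/-- There is no finite group of order 2688 with an irreducible complex character
of degree 48. -/
theorem no_group_order_2688_degree_48 (G : Type) [Group G] [Finite G]
    (hcard : Nat.card G = 2688)
    (χ : G → ℂ) (hχ : IsIrrChar G χ) (hdeg : χ 1 = (48 : ℂ)) :
    False := by
  classical
  obtain ⟨V, hV, rfl⟩ := hχ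
  have := Fintype.ofFinite G
  have hG : (Nat.card G : ℂ) ≠ 0 := Nat.cast_ne_zero.2 Nat.card_pos.ne'
  let := invertibleOfNonzero hG
  let ρ : Representation ℂ G V := V.ρ
  have hρ (g : G) : V.character g = ρ.character g := rfl
  have hrank : Module.finrank ℂ V = 48 := by
    rw [FDRep.char_one] at hdeg
    exact_mod_cast hdeg
  have hnorm : ∑ g, ‖ρ.character g‖ ^ 2 = 2688 := by
    have h := FDRep.char_orthonormal V V
    rw [if_pos ⟨Iso.refl V⟩, inv_mul_eq_iff_eq_mul₀ hG, hcard] at h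
    simp only [hρ, ρ.char_inv_eq_conj, Complex.mul_conj'] at h
    exact_mod_cast h
  have : Fact (Nat.Prime 7) := ⟨by norm_num⟩
  have hsing := ρ.card_le_mul_sum_norm_sq_char_singular (p := 7) (by rw [hcard]; norm_num)
    (by rw [hcard]; norm_num) (by rw [hrank]; norm_num)
  have hzero (g : G) (hg : g ≠ 1) (h7 : ¬ 7 ∣ orderOf g) : ρ.character g = 0 := by
    by_contra hne
    have hlt : ∑ y with 7 ∣ orderOf y, ‖ρ.character y‖ ^ 2 + 48 ^ 2 < 2688 := by
      have h1 : (48 : ℝ) ^ 2 = ‖ρ.character 1‖ ^ 2 := by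
        rw [ρ.char_one, hrank]
        norm_num
      have h2 : (1 : G) ∉ ({y | 7 ∣ orderOf y} : Finset G) := by simp
      rw [← hnorm, h1, add_comm, ← Finset.sum_insert (f := fun y ↦ ‖ρ.character y‖ ^ 2) h2]
      refine Finset.sum_lt_sum_of_subset (Finset.subset_univ _) (Finset.mem_univ g) ?_
        (by positivity) fun _ _ _ ↦ by positivity
      simp [hg, h7]
    rw [hcard] at hsing
    norm_num at hsing hlt
    linarith
  have : Fact (Nat.Prime 2) := ⟨Nat.prime_two⟩
  obtain ⟨Q, hQ⟩ := Sylow.exists_subgroup_card_pow_prime (G := G) 2 (n := 7)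
    (by rw [hcard]; norm_num)
  have hdvd : Nat.card Q ∣ Module.finrank ℂ V := by
    refine Representation.card_dvd_finrank_of_char_eq_zero (MonoidHom.comp ρ Q.subtype) ?_
    intro g hg
    refine hzero g (by simpa using hg) fun h ↦ ?_
    rw [Subgroup.orderOf_coe] at h
    have h7 := h.trans (orderOf_dvd_natCard g)
    rw [hQ] at h7
    norm_num at h7
  rw [hQ, hrank] at hdvd
  norm_num at hdvd
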